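/- Let H be a finite-dimensional complex Hilbert space, T ∈ L(H) nonzero, and V an n-dimensional subspace of L(H). If w(T + λS) ≥ w(T) for all scalars λ and all S ∈ V, then there exist h ≤ 2n+1, t₁,…,t_h > 0 with Σ tᵢ = 1, and unit vectors x₁,…,x_h ∈ H with |⟨T xᵢ, xᵢ⟩| = w(T) for all i, such that Σᵢ tᵢ · conj(⟨T xᵢ, xᵢ⟩) · ⟨S xᵢ, xᵢ⟩ = 0 for all S ∈ V. -/

import Mathlib

open scoped InnerProductSpace

/-- The numerical radius of an operator on a complex Hilbert space. -/
noncomputable def nradH {H : Type*} [NormedAddCommGroup H] [InnerProductSpace ℂ H]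
    (T : H →L[ℂ] H) : ℝ :=
  sSup {r : ℝ | ∃ x : H, ‖x‖ = 1 ∧ r = ‖(⟪T x, x⟫_ℂ)‖}

theorem aux_compact_hull {E : Type*} [NormedAddCommGroup E] [NormedSpace ℝ E]
    [FiniteDimensional ℝ E] {s : Set E} (hs : IsCompact s) : IsCompact (convexHull ℝ s) := by
  set N := Module.finrank ℝ E + 1 with hN
  have hc : IsCompact ((stdSimplex ℝ (Fin N)) ×ˢ (Set.univ.pi fun _ : Fin N => s)) :=
    (isCompact_stdSimplex ℝ (Fin N)).prod (isCompact_univ_pi fun _ => hs)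
  have himg := hc.image (f := fun p : (Fin N → ℝ) × (Fin N → E) => ∑ j, p.1 j • p.2 j)
    (by fun_prop)
  convert himg using 1
  ext x
  constructor
  · intro hx
    obtain ⟨ι, _, z, w, hz, haff, hw, hw1, hwx⟩ := eq_pos_convex_span_of_mem_convexHull hx
    have hcard : Fintype.card ι ≤ Fintype.card (Fin N) := by
      rw [Fintype.card_fin]
      exact haff.card_le_finrank_succ.trans (Nat.add_le_add_right (Submodule.finrank_le _) 1)
    obtain ⟨e⟩ := Function.Embedding.nonempty_of_card_le hcard
    have hne : Nonempty ι := by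
      by_contra h
      rw [not_nonempty_iff] at h
      simp at hw1
    refine ⟨(fun j => ∑ i, if e i = j then w i else 0, fun j => z (Function.invFun e j)), ?_, ?_⟩
    · refine ⟨⟨fun j => Finset.sum_nonneg fun i _ => ?_, ?_⟩, fun j _ => hz ⟨_, rfl⟩⟩
      · split_ifs
        · exact (hw i).le
        · exact le_rfl
      · dsimp only
        rw [Finset.sum_comm]
        simpa using hw1
    · dsimp only
      simp_rw [Finset.sum_smul]
      rw [Finset.sum_comm]
      simp only [ite_smul, zero_smul, Finset.sum_ite_eq, Finset.mem_univ, if_true]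
      simp_rw [Function.leftInverse_invFun e.injective _]
      exact hwx
  · rintro ⟨⟨w, z⟩, ⟨hw, hz⟩, rfl⟩
    exact (convex_convexHull ℝ s).sum_mem (fun i _ => hw.1 i) hw.2
      (fun i _ => subset_convexHull ℝ s (hz i trivial))

section
variable {H : Type*} [NormedAddCommGroup H] [InnerProductSpace ℂ H] [FiniteDimensional ℂ H]

theorem aux_max [Nontrivial H] (T : H →L[ℂ] H) :
    ∃ x : H, ‖x‖ = 1 ∧ nradH T = ‖⟪T x, x⟫_ℂ‖ ∧ ∀ y : H, ‖y‖ = 1 → ‖⟪T y, y⟫_ℂ‖ ≤ nradH T := by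
  have : ProperSpace H := FiniteDimensional.proper ℂ H
  obtain ⟨x0, hx0⟩ := exists_norm_eq H (zero_le_one (α := ℝ))
  obtain ⟨x, hx, h1, h2⟩ := (isCompact_sphere (0 : H) 1).exists_sSup_image_eq_and_ge
    ⟨x0, by simpa using hx0⟩ (f := fun y : H => ‖⟪T y, y⟫_ℂ‖) (by fun_prop)
  have e : nradH T = ‖⟪T x, x⟫_ℂ‖ := by
    rw [← h1, nradH]
    congr 1
    ext r
    simp [eq_comm]
  refine ⟨x, by simpa using hx, e, fun y hy => ?_⟩
  rw [e]
  exact h2 y (by simpa using hy)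

/-- If `S` is such that orthogonality holds, there is a maximizer with nonpositive real part. -/
theorem aux_dir [Nontrivial H] (T S : H →L[ℂ] H)
    (h : ∀ c : ℂ, nradH T ≤ nradH (T + c • S)) :
    ∃ x : H, ‖x‖ = 1 ∧ ‖⟪T x, x⟫_ℂ‖ = nradH T ∧
      (starRingEnd ℂ ⟪T x, x⟫_ℂ * ⟪S x, x⟫_ℂ).re ≤ 0 := by
  have : ProperSpace H := FiniteDimensional.proper ℂ H
  set l : ℕ → ℝ := fun k => 1 / ((k : ℝ) + 1) with hl
  have hlpos : ∀ k, 0 < l k := fun k => by positivity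
  have hl0 : Filter.Tendsto l Filter.atTop (nhds 0) := tendsto_one_div_add_atTop_nhds_zero_nat
  choose x hx1 hx2 _ using fun k => aux_max (T + (-(l k : ℂ)) • S)
  obtain ⟨_, _, _, hT⟩ := aux_max T
  have hexp : ∀ k, ⟪(T + (-(l k : ℂ)) • S) (x k), x k⟫_ℂ
      = ⟪T (x k), x k⟫_ℂ - (l k : ℂ) * ⟪S (x k), x k⟫_ℂ := by
    intro k
    simp [inner_add_left, inner_smul_left, sub_eq_add_neg, -neg_smul, mul_comm]
  have hge : ∀ k, nradH T ≤ ‖⟪T (x k), x k⟫_ℂ - (l k : ℂ) * ⟪S (x k), x k⟫_ℂ‖ := by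
    intro k
    rw [← hexp, ← hx2]
    exact h _
  have hre : ∀ k, 2 * (starRingEnd ℂ ⟪T (x k), x k⟫_ℂ * ⟪S (x k), x k⟫_ℂ).re
      ≤ l k * ‖⟪S (x k), x k⟫_ℂ‖ ^ 2 := by
    intro k
    have h1 := hge k
    have h2 := hT (x k) (hx1 k)
    have h3 : ‖⟪T (x k), x k⟫_ℂ‖ ^ 2 ≤ ‖⟪T (x k), x k⟫_ℂ - (l k : ℂ) * ⟪S (x k), x k⟫_ℂ‖ ^ 2 := by
      gcongr
      exact h2.trans h1
    generalize ⟪T (x k), x k⟫_ℂ = a at *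
    generalize ⟪S (x k), x k⟫_ℂ = b at *
    have hp := hlpos k
    generalize l k = r at *
    rw [← Complex.normSq_eq_norm_sq, ← Complex.normSq_eq_norm_sq] at h3
    rw [← Complex.normSq_eq_norm_sq]
    simp only [Complex.normSq_apply, Complex.sub_re, Complex.sub_im, Complex.mul_re,
      Complex.mul_im, Complex.ofReal_re, Complex.ofReal_im, Complex.conj_re,
      Complex.conj_im] at *
    refine le_of_mul_le_mul_left ?_ hp
    nlinarith
  obtain ⟨y, hy, φ, hφ, hlim⟩ := (isCompact_sphere (0 : H) 1).tendsto_subseq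
    (x := x) (fun k => by simpa using hx1 k)
  have hy1 : ‖y‖ = 1 := by simpa using hy
  have hlφ := hl0.comp hφ.tendsto_atTop
  have tT : Filter.Tendsto (fun k => ⟪T (x (φ k)), x (φ k)⟫_ℂ) Filter.atTop (nhds ⟪T y, y⟫_ℂ) :=
    (Continuous.tendsto (f := fun y : H => ⟪T y, y⟫_ℂ) (by fun_prop) y).comp hlim
  have tS : Filter.Tendsto (fun k => ⟪S (x (φ k)), x (φ k)⟫_ℂ) Filter.atTop (nhds ⟪S y, y⟫_ℂ) :=
    (Continuous.tendsto (f := fun y : H => ⟪S y, y⟫_ℂ) (by fun_prop) y).comp hlim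
  have tl : Filter.Tendsto (fun k => ((l (φ k) : ℝ) : ℂ)) Filter.atTop (nhds ((0 : ℝ) : ℂ)) :=
    (Complex.continuous_ofReal.tendsto 0).comp hlφ
  refine ⟨y, hy1, le_antisymm (hT y hy1) ?_, ?_⟩
  · have := ge_of_tendsto' (tT.sub (tl.mul tS)).norm (fun k => hge (φ k))
    simpa using this
  · have t1 := (Complex.continuous_re.tendsto _).comp
      (((Complex.continuous_conj.tendsto _).comp tT).mul tS)
    have := le_of_tendsto_of_tendsto' (t1.const_mul 2) (hlφ.mul (tS.norm.pow 2))
      (fun k => hre (φ k))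
    simp only [zero_mul] at this
    linarith

end

theorem stmt_12 {H : Type*} [NormedAddCommGroup H] [InnerProductSpace ℂ H]
    [FiniteDimensional ℂ H]
    (T : H →L[ℂ] H) (hT : T ≠ 0) (n : ℕ) (V : Submodule ℂ (H →L[ℂ] H))
    (hV : Module.finrank ℂ V = n)
    (horth : ∀ S ∈ V, ∀ c : ℂ, nradH T ≤ nradH (T + c • S)) :
    ∃ (h : ℕ), 0 < h ∧ h ≤ 2 * n + 1 ∧
      ∃ (t : Fin h → ℝ) (x : Fin h → H),
        (∀ i, 0 < t i) ∧ (∑ i, t i = 1) ∧ (∀ i, ‖x i‖ = 1) ∧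
        (∀ i, ‖(⟪T (x i), x i⟫_ℂ)‖ = nradH T) ∧
        (∀ S ∈ V, ∑ i, (t i : ℂ) * (starRingEnd ℂ ⟪T (x i), x i⟫_ℂ) * ⟪S (x i), x i⟫_ℂ = 0) := by
  have : ProperSpace H := FiniteDimensional.proper ℂ H
  have hnt : Nontrivial H := by
    by_contra h
    rw [not_nontrivial_iff_subsingleton] at h
    exact hT (Subsingleton.elim _ _)
  let b : Module.Basis (Fin n) ℂ V := Module.finBasisOfFinrankEq ℂ V hV
  let Φ : H → (Fin n → ℂ) := fun x i =>
    (starRingEnd ℂ ⟪T x, x⟫_ℂ) * ⟪(b i : H →L[ℂ] H) x, x⟫_ℂ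
  have hΦ : Continuous Φ := by
    refine continuous_pi fun i => ?_
    exact (Complex.continuous_conj.comp (by fun_prop)).mul (by fun_prop)
  let K : Set H := {x | ‖x‖ = 1 ∧ ‖⟪T x, x⟫_ℂ‖ = nradH T}
  have hK : IsCompact K := by
    have : K = Metric.sphere (0 : H) 1 ∩ {x | ‖⟪T x, x⟫_ℂ‖ = nradH T} := by
      ext x; simp [K]
    rw [this]
    exact (isCompact_sphere (0 : H) 1).inter_right
      (isClosed_eq (by fun_prop) continuous_const)
  have h0 : (0 : Fin n → ℂ) ∈ convexHull ℝ (Φ '' K) := by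
    by_contra hcon
    obtain ⟨f, u, hu, hf⟩ := RCLike.geometric_hahn_banach_point_closed (𝕜 := ℂ)
      (convex_convexHull ℝ (Φ '' K)) (aux_compact_hull (hK.image hΦ)).isClosed hcon
    let S : V := ∑ i, (starRingEnd ℂ (f (Pi.single i 1))) • b i
    obtain ⟨x, hx1, hx2, hx3⟩ := aux_dir T S (horth S S.2)
    have h1 := hf (Φ x) (subset_convexHull ℝ _ ⟨x, ⟨hx1, hx2⟩, rfl⟩)
    have h2 : f (Φ x) = starRingEnd ℂ ⟪T x, x⟫_ℂ * ⟪(S : H →L[ℂ] H) x, x⟫_ℂ := by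
      have e1 : f (Φ x) = ∑ i, Φ x i * f (Pi.single i 1) := by
        conv_lhs => rw [pi_eq_sum_univ' (Φ x)]
        rw [map_sum]
        refine Finset.sum_congr rfl fun i _ => ?_
        rw [map_smul, smul_eq_mul]
      rw [e1]
      simp only [S, Φ, Submodule.coe_sum, Submodule.coe_smul, sum_apply,
        smul_apply, sum_inner, inner_smul_left, Complex.conj_conj,
        Finset.mul_sum]
      refine Finset.sum_congr rfl fun i _ => ?_
      ring
    rw [h2] at h1
    simp only [map_zero] at hu
    simp only [RCLike.re_to_complex] at h1
    linarith
  obtain ⟨ι, _, z, w, hz, haff, hw, hw1, hwx⟩ := eq_pos_convex_span_of_mem_convexHull h0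
  have hcard : Fintype.card ι ≤ 2 * n + 1 := by
    have h1 := haff.card_le_finrank_succ.trans (Nat.add_le_add_right (Submodule.finrank_le _) 1)
    rwa [finrank_real_of_complex, Module.finrank_fin_fun] at h1
  have hne : Nonempty ι := by
    by_contra h
    rw [not_nonempty_iff] at h
    simp at hw1
  choose x hx hxz using fun i => hz ⟨i, rfl⟩
  let e := (Fintype.equivFin ι).symm
  refine ⟨Fintype.card ι, Fintype.card_pos, hcard, fun i => w (e i), fun i => x (e i),
    fun i => hw _, ?_, fun i => (hx _).1, fun i => (hx _).2, ?_⟩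
  · rw [← hw1]
    exact e.sum_comp w
  · intro S hS
    rw [e.sum_comp (fun i => (w i : ℂ) * (starRingEnd ℂ ⟪T (x i), x i⟫_ℂ) * ⟪S (x i), x i⟫_ℂ)]
    have hb : ∀ j, ∑ i, (w i : ℂ) * (starRingEnd ℂ ⟪T (x i), x i⟫_ℂ) *
        ⟪(b j : H →L[ℂ] H) (x i), x i⟫_ℂ = 0 := by
      intro j
      have := congrFun hwx j
      simp only [← hxz, Finset.sum_apply, Pi.smul_apply, Φ, Complex.real_smul,
        Pi.zero_apply] at this
      simpa only [mul_assoc] using this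
    have hSb : S = ∑ j, b.repr ⟨S, hS⟩ j • (b j : H →L[ℂ] H) := by
      have := congrArg (Subtype.val) (b.sum_repr ⟨S, hS⟩)
      rw [Submodule.coe_sum] at this
      exact this.symm
    rw [hSb]
    simp only [sum_apply,
        smul_apply, sum_inner, inner_smul_left,
        Finset.mul_sum]
    rw [Finset.sum_comm]
    refine Finset.sum_eq_zero fun j _ => ?_
    have := congrArg (fun c => starRingEnd ℂ (b.repr ⟨S, hS⟩ j) * c) (hb j)
    simp only [Finset.mul_sum, mul_zero] at this
    rw [← this]
    refine Finset.sum_congr rfl fun i _ => ?_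
    ring
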